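/- arXiv:1711.03742 — 2 statements merged into one kernel-verified Lean document; each statement's English description precedes it below -/
import Mathlib

section
/- Let p, q be distinct atoms and let Φ be the agenda list [p, q, p⊙q, (p⊙q)\⊥] of Lambek-calculus formulas. For n = 3 agents, the profile consisting of the judgment lists J_1 = [p, q, p⊙q], J_2 = [p, (p⊙q)\⊥], J_3 = [q, (p⊙q)\⊥] (as sublists of Φ) consists of robustly consistent lists, yet its majority outcome is the list [p, q, (p⊙q)\⊥], which is L-inconsistent: the sequent p; q; (p⊙q)\⊥ ⊢ ⊥ is derivable in the Lambek calculus. Hence the Lambek calculus is not safe for the majority rule. -/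
namespace Stmt6

/-- Formulas of the Lambek calculus: atoms, ⊥, product ⊙, and \ and / implications. -/
inductive LForm : Type
  | atom : ℕ → LForm
  | bot  : LForm
  | prod : LForm → LForm → LForm          -- A ⊙ B
  | lDiv : LForm → LForm → LForm          -- A \ B
  | rDiv : LForm → LForm → LForm          -- B / A
  deriving DecidableEq

/-- Sequent derivability Γ ⊢ C in the Lambek calculus (lists, no structural rules). -/
inductive LDeriv : List LForm → LForm → Prop
  | ax (A) : LDeriv [A] A
  | cut {Γ Δ₁ Δ₂ A C} : LDeriv Γ A → LDeriv (Δ₁ ++ A :: Δ₂) C →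
      LDeriv (Δ₁ ++ Γ ++ Δ₂) C
  | prodL {Γ₁ Γ₂ A B C} : LDeriv (Γ₁ ++ A :: B :: Γ₂) C →
      LDeriv (Γ₁ ++ LForm.prod A B :: Γ₂) C
  | prodR {Γ Δ A B} : LDeriv Γ A → LDeriv Δ B → LDeriv (Γ ++ Δ) (LForm.prod A B)
  | lDivL {Γ Δ₁ Δ₂ A B C} : LDeriv Γ A → LDeriv (Δ₁ ++ B :: Δ₂) C →
      LDeriv (Δ₁ ++ Γ ++ LForm.lDiv A B :: Δ₂) C
  | lDivR {Γ A B} : LDeriv (A :: Γ) B → LDeriv Γ (LForm.lDiv A B)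
  | rDivL {Γ Δ₁ Δ₂ A B C} : LDeriv Γ A → LDeriv (Δ₁ ++ B :: Δ₂) C →
      LDeriv (Δ₁ ++ LForm.rDiv B A :: Γ ++ Δ₂) C
  | rDivR {Γ A B} : LDeriv (Γ ++ [A]) B → LDeriv Γ (LForm.rDiv B A)

/-- A list of formulas is L-inconsistent if it derives ⊥. -/
def LInconsistent (Γ : List LForm) : Prop := LDeriv Γ .bot

/-- Robust consistency: every sublist is L-consistent. -/
def robustlyConsistent (Γ : List LForm) : Prop :=
  ∀ Δ : List LForm, Δ.Sublist Γ → ¬ LInconsistent Δ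

/-- The sublist of the agenda Φ given by a set of positions. -/
def sublistOf (Φ : List LForm) (J : Finset ℕ) : List LForm :=
  ((List.range Φ.length).filter (fun j => decide (j ∈ J))).map (fun j => Φ.getD j .bot)

/-- Majority positions: positions accepted by more than n/2 agents. -/
def majPos (n : ℕ) (Φ : List LForm) (J : Fin n → Finset ℕ) : Finset ℕ :=
  (Finset.range Φ.length).filter
    (fun j => n < 2 * (Finset.univ.filter (fun i => j ∈ J i)).card)

/-- The majority outcome: the sublist of Φ at the majority positions. -/
def majList (n : ℕ) (Φ : List LForm) (J : Fin n → Finset ℕ) : List LForm :=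
  sublistOf Φ (majPos n Φ J)

def p : LForm := .atom 0
def q : LForm := .atom 1

/-- The agenda list [p, q, p⊙q, (p⊙q)\⊥]. -/
def Φ : List LForm := [p, q, p.prod q, (p.prod q).lDiv .bot]

/-- The profile J₁ = [p,q,p⊙q], J₂ = [p,(p⊙q)\⊥], J₃ = [q,(p⊙q)\⊥], as sets of positions. -/
def Jprof : Fin 3 → Finset ℕ := fun i =>
  if i = 0 then {0, 1, 2} else if i = 1 then {0, 3} else {1, 3}

/-- Valuation into the integers, invariant under derivability. -/
def val : LForm → ℤ
  | .atom _ => 1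
  | .bot => 10
  | .prod A B => val A + val B
  | .lDiv A B => val B - val A
  | .rDiv B A => val B - val A

lemma val_sound {Γ : List LForm} {C : LForm} (h : LDeriv Γ C) : (Γ.map val).sum = val C := by
  induction h <;> simp [val] at * <;> linarith

lemma robust_of {Γ : List LForm} (h : ∀ Δ ∈ Γ.sublists, (Δ.map val).sum ≠ 10) :
    robustlyConsistent Γ := by
  intro Δ hs hd
  exact h Δ (List.mem_sublists.2 hs) (val_sound hd)

/-- the profile above consists of robustly consistent judgment lists over
the Lambek agenda [p, q, p⊙q, (p⊙q)\⊥], yet its majority outcome is the L-inconsistent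
list [p, q, (p⊙q)\⊥]: the sequent p; q; (p⊙q)\⊥ ⊢ ⊥ is derivable in the Lambek
calculus.  Hence the Lambek calculus is not safe for the majority rule. -/
theorem lambek_not_safe :
    (∀ i, (Jprof i) ⊆ Finset.range Φ.length ∧ robustlyConsistent (sublistOf Φ (Jprof i))) ∧
    majList 3 Φ Jprof = [p, q, (p.prod q).lDiv .bot] ∧
    LDeriv [p, q, (p.prod q).lDiv .bot] .bot ∧
    ¬ robustlyConsistent (majList 3 Φ Jprof) := by
  have hm : majList 3 Φ Jprof = [p, q, (p.prod q).lDiv .bot] := by decide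
  have hd : LDeriv [p, q, (p.prod q).lDiv .bot] .bot :=
    LDeriv.lDivL (Γ := [p, q]) (Δ₁ := []) (Δ₂ := [])
      (LDeriv.prodR (Γ := [p]) (Δ := [q]) (LDeriv.ax p) (LDeriv.ax q)) (LDeriv.ax _)
  refine ⟨fun i => ⟨?_, robust_of ?_⟩, hm, hd, fun h => ?_⟩
  · revert i; decide
  · revert i; decide
  · rw [hm] at h
    exact h _ (List.Sublist.refl _) hd

end Stmt6
end

section
/- Let p, q be distinct atoms and let Φ be the MALL agenda {p, ¬p, q, ¬q, p⊗q, ¬(p⊗q)}. For n = 3 agents, the profile J_1 = {p, q, p⊗q}, J_2 = {p, ¬q, ¬(p⊗q)}, J_3 = {¬p, q, ¬(p⊗q)} consists of robustly consistent and complete judgment sets over Φ, yet its majority outcome is {p, q, ¬(p⊗q)}, which is MALL-inconsistent: the sequent p, q, ¬(p⊗q) ⊢ (with empty succedent) is derivable in MALL. Hence multiplicative additive linear logic is not safe for the majority rule. -/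
namespace Stmt8

/-- Formulas of multiplicative additive linear logic (MALL). -/
inductive MForm : Type
  | atom  : ℕ → MForm
  | neg   : MForm → MForm
  | tens  : MForm → MForm → MForm         -- ⊗
  | parr  : MForm → MForm → MForm         -- ⅋
  | lolli : MForm → MForm → MForm         -- ⊸
  | one   : MForm                         -- 1
  | bot   : MForm                         -- ⊥
  | awith : MForm → MForm → MForm         -- &
  | aplus : MForm → MForm → MForm         -- ⊕
  | top   : MForm                         -- ⊤
  | zero  : MForm                         -- 0
  deriving DecidableEq

/-- Two-sided sequent calculus for MALL on multisets (no weakening, no contraction). -/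
inductive MDeriv : Multiset MForm → Multiset MForm → Prop
  | ax (A) : MDeriv {A} {A}
  | cut {Γ Δ Γ' Δ' A} : MDeriv (A ::ₘ Γ) Δ → MDeriv Γ' (A ::ₘ Δ') →
      MDeriv (Γ + Γ') (Δ + Δ')
  | negL {Γ Δ A} : MDeriv Γ (A ::ₘ Δ) → MDeriv (MForm.neg A ::ₘ Γ) Δ
  | negR {Γ Δ A} : MDeriv (A ::ₘ Γ) Δ → MDeriv Γ (MForm.neg A ::ₘ Δ)
  | tensR {Γ Δ Γ' Δ' A B} : MDeriv Γ (A ::ₘ Δ) → MDeriv Γ' (B ::ₘ Δ') →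
      MDeriv (Γ + Γ') (MForm.tens A B ::ₘ (Δ + Δ'))
  | tensL {Γ Δ A B} : MDeriv (A ::ₘ B ::ₘ Γ) Δ → MDeriv (MForm.tens A B ::ₘ Γ) Δ
  | parrL {Γ Δ Γ' Δ' A B} : MDeriv (A ::ₘ Γ) Δ → MDeriv (B ::ₘ Γ') Δ' →
      MDeriv (MForm.parr A B ::ₘ (Γ + Γ')) (Δ + Δ')
  | parrR {Γ Δ A B} : MDeriv Γ (A ::ₘ B ::ₘ Δ) → MDeriv Γ (MForm.parr A B ::ₘ Δ)
  | lolliL {Γ Δ Γ' Δ' A B} : MDeriv Γ (A ::ₘ Δ) → MDeriv (B ::ₘ Γ') Δ' →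
      MDeriv (MForm.lolli A B ::ₘ (Γ + Γ')) (Δ + Δ')
  | lolliR {Γ Δ A B} : MDeriv (A ::ₘ Γ) (B ::ₘ Δ) → MDeriv Γ (MForm.lolli A B ::ₘ Δ)
  | oneR : MDeriv 0 {MForm.one}
  | oneL {Γ Δ} : MDeriv Γ Δ → MDeriv (MForm.one ::ₘ Γ) Δ
  | botL : MDeriv {MForm.bot} 0
  | botR {Γ Δ} : MDeriv Γ Δ → MDeriv Γ (MForm.bot ::ₘ Δ)
  | withR {Γ Δ A B} : MDeriv Γ (A ::ₘ Δ) → MDeriv Γ (B ::ₘ Δ) →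
      MDeriv Γ (MForm.awith A B ::ₘ Δ)
  | withL1 {Γ Δ A B} : MDeriv (A ::ₘ Γ) Δ → MDeriv (MForm.awith A B ::ₘ Γ) Δ
  | withL2 {Γ Δ A B} : MDeriv (B ::ₘ Γ) Δ → MDeriv (MForm.awith A B ::ₘ Γ) Δ
  | plusL {Γ Δ A B} : MDeriv (A ::ₘ Γ) Δ → MDeriv (B ::ₘ Γ) Δ →
      MDeriv (MForm.aplus A B ::ₘ Γ) Δ
  | plusR1 {Γ Δ A B} : MDeriv Γ (A ::ₘ Δ) → MDeriv Γ (MForm.aplus A B ::ₘ Δ)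
  | plusR2 {Γ Δ A B} : MDeriv Γ (B ::ₘ Δ) → MDeriv Γ (MForm.aplus A B ::ₘ Δ)
  | topR (Γ Δ) : MDeriv Γ (MForm.top ::ₘ Δ)
  | zeroL (Γ Δ) : MDeriv (MForm.zero ::ₘ Γ) Δ

/-- MALL-inconsistency of a multiset: Γ ⊢ (empty succedent) is derivable. -/
def MInconsistent (Γ : Multiset MForm) : Prop := MDeriv Γ 0

/-- Robust consistency: every submultiset is MALL-consistent. -/
def robustlyConsistent (Γ : Multiset MForm) : Prop :=
  ∀ Δ : Multiset MForm, Δ ≤ Γ → ¬ MInconsistent Δ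

/-- The complement ∼φ. -/
def MForm.compl : MForm → MForm
  | .neg ψ => ψ
  | φ      => .neg φ

def isTautology (φ : MForm) : Prop := MDeriv 0 {φ}
def isContradiction (φ : MForm) : Prop := MDeriv {φ} 0

/-- A MALL agenda: finite, closed under complement, no tautologies or contradictions. -/
def isAgenda (Φ : Finset MForm) : Prop :=
  (∀ φ ∈ Φ, φ.compl ∈ Φ) ∧ ∀ φ ∈ Φ, ¬ isTautology φ ∧ ¬ isContradiction φ

def completeOn (Φ J : Finset MForm) : Prop := ∀ φ ∈ Φ, φ ∈ J ∨ φ.compl ∈ J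

def complementFree (J : Finset MForm) : Prop := ∀ φ ∈ J, φ.compl ∉ J

/-- Profiles of robustly consistent and complete judgment sets over Φ. -/
def ratProfile (n : ℕ) (Φ : Finset MForm) (J : Fin n → Finset MForm) : Prop :=
  ∀ i, J i ⊆ Φ ∧ robustlyConsistent (J i).val ∧ completeOn Φ (J i)

def nsupp (n : ℕ) (J : Fin n → Finset MForm) (φ : MForm) : ℕ :=
  (Finset.univ.filter (fun i => φ ∈ J i)).card

/-- The majority rule. -/
def maj (n : ℕ) (Φ : Finset MForm) (J : Fin n → Finset MForm) : Finset MForm :=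
  Φ.filter (fun φ => n < 2 * nsupp n J φ)

def p : MForm := .atom 0
def q : MForm := .atom 1

/-- The agenda {p, ¬p, q, ¬q, p⊗q, ¬(p⊗q)}. -/
def Φ : Finset MForm := {p, .neg p, q, .neg q, p.tens q, .neg (p.tens q)}

/-- The profile J₁ = {p,q,p⊗q}, J₂ = {p,¬q,¬(p⊗q)}, J₃ = {¬p,q,¬(p⊗q)}. -/
def Jprof : Fin 3 → Finset MForm := fun i =>
  if i = 0 then {p, q, p.tens q}
  else if i = 1 then {p, .neg q, .neg (p.tens q)}
  else {.neg p, q, .neg (p.tens q)}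

/-- Classical truth-value semantics. -/
def ev (v : ℕ → Prop) : MForm → Prop
  | .atom n => v n
  | .neg A => ¬ ev v A
  | .tens A B => ev v A ∧ ev v B
  | .parr A B => ev v A ∨ ev v B
  | .lolli A B => ev v A → ev v B
  | .one => True
  | .bot => False
  | .awith A B => ev v A ∧ ev v B
  | .aplus A B => ev v A ∨ ev v B
  | .top => True
  | .zero => False

/-- MALL derivations are classically sound. -/
theorem sound (v : ℕ → Prop) {Γ Δ : Multiset MForm} (h : MDeriv Γ Δ) :
    (∀ A ∈ Γ, ev v A) → ∃ B ∈ Δ, ev v B := by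
  induction h <;>
    simp only [Multiset.mem_cons, Multiset.mem_add, Multiset.mem_singleton,
      or_imp, forall_and, or_and_right, exists_or, forall_eq, exists_eq_left,
      ev, Multiset.notMem_zero, false_and, exists_false, IsEmpty.forall_iff, implies_true] at * <;>
    first | tauto | grind

theorem cons_of_model (v : ℕ → Prop) {Γ : Multiset MForm} (h : ∀ A ∈ Γ, ev v A) :
    robustlyConsistent Γ := by
  intro Δ hΔ hd
  obtain ⟨B, hB, _⟩ := sound v hd (fun A hA => h A (Multiset.mem_of_le hΔ hA))
  simp at hB

theorem not_taut (v : ℕ → Prop) {A : MForm} (h : ¬ ev v A) : ¬ isTautology A := by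
  intro hd
  obtain ⟨B, hB, hv⟩ := sound v hd (by simp)
  rw [Multiset.mem_singleton] at hB
  exact h (hB ▸ hv)

theorem not_contra (v : ℕ → Prop) {A : MForm} (h : ev v A) : ¬ isContradiction A := by
  intro hd
  obtain ⟨B, hB, _⟩ := sound v hd (by simpa using h)
  simp at hB

theorem maj_eq : maj 3 Φ Jprof = {p, q, .neg (p.tens q)} := by decide

theorem incons : MDeriv ({p, q, .neg (p.tens q)} : Finset MForm).val 0 := by
  have h : MDeriv (({p} : Multiset MForm) + {q}) (p.tens q ::ₘ (0 + 0)) :=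
    MDeriv.tensR (MDeriv.ax p) (MDeriv.ax q)
  have h2 := MDeriv.negL h
  have e : ({p, q, .neg (p.tens q)} : Finset MForm).val
      = MForm.neg (p.tens q) ::ₘ (({p} : Multiset MForm) + {q}) := by decide
  rw [e]
  exact h2

/-- the profile above consists of robustly consistent and complete judgment
sets over the MALL agenda {p,¬p,q,¬q,p⊗q,¬(p⊗q)}, yet its majority outcome is
{p, q, ¬(p⊗q)}, which is MALL-inconsistent: the sequent p, q, ¬(p⊗q) ⊢ is derivable in
MALL.  Hence MALL is not safe for the majority rule. -/
theorem mall_not_safe :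
    isAgenda Φ ∧
    ratProfile 3 Φ Jprof ∧
    maj 3 Φ Jprof = {p, q, .neg (p.tens q)} ∧
    MDeriv ({p, q, .neg (p.tens q)} : Finset MForm).val 0 ∧
    ¬ robustlyConsistent (maj 3 Φ Jprof).val := by
  refine ⟨⟨by decide, ?_⟩, ?_, maj_eq, incons, ?_⟩
  · intro φ hφ
    simp only [Φ, Finset.mem_insert, Finset.mem_singleton] at hφ
    rcases hφ with rfl | rfl | rfl | rfl | rfl | rfl
    · exact ⟨not_taut (fun _ => False) (by simp [ev, p]), not_contra (fun _ => True) (by simp [ev, p])⟩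
    · exact ⟨not_taut (fun _ => True) (by simp [ev, p]), not_contra (fun _ => False) (by simp [ev, p])⟩
    · exact ⟨not_taut (fun _ => False) (by simp [ev, q]), not_contra (fun _ => True) (by simp [ev, q])⟩
    · exact ⟨not_taut (fun _ => True) (by simp [ev, q]), not_contra (fun _ => False) (by simp [ev, q])⟩
    · exact ⟨not_taut (fun _ => False) (by simp [ev, p, q]),
        not_contra (fun _ => True) (by simp [ev, p, q])⟩
    · exact ⟨not_taut (fun _ => True) (by simp [ev, p, q]),
        not_contra (fun _ => False) (by simp [ev, p, q])⟩
  · intro i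
    refine ⟨by revert i; decide, ?_, by revert i; unfold completeOn; decide⟩
    fin_cases i
    · refine cons_of_model (fun _ => True) (fun A hA => ?_)
      rw [Finset.mem_val] at hA
      simp [Jprof] at hA
      rcases hA with rfl | rfl | rfl <;> simp [ev, p, q]
    · refine cons_of_model (fun n => n = 0) (fun A hA => ?_)
      rw [Finset.mem_val] at hA
      simp [Jprof] at hA
      rcases hA with rfl | rfl | rfl <;> simp [ev, p, q]
    · refine cons_of_model (fun n => n = 1) (fun A hA => ?_)
      rw [Finset.mem_val] at hA
      simp [Jprof] at hA
      rcases hA with rfl | rfl | rfl <;> simp [ev, p, q]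
  · intro h
    rw [maj_eq] at h
    exact h _ le_rfl incons

end Stmt8
end
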